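/- arXiv:2310.07350 — 5 statements merged into one kernel-verified Lean document; each statement's English description precedes it below -/
import Mathlib

section
/- In the network G_2, consider any routing table at c, i.e., any function f : {1, …, 2n} → {(1,0), (0,1)} choosing for each destination v_j one of the two directed edges from c to v_j, and let the routed path from v_i to v_j (for i ≠ j) be the edge v_i → c followed by the chosen edge c → v_j. Then the number of ordered pairs (i, j) with i ≠ j for which the routed path has some cost coordinate ≥ 2 is at least 2n(n−1); equivalently, the routing finds paths with both cost coordinates strictly less than 2 for at most (2n+1)² − 2n(n−1) of the (2n+1)² ordered pairs of vertices of G_2. -/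
/-- Cost vector of the unique edge from the vertex `v_{i+1}` (0-indexed `i : Fin (2*n)`)
back to the centre `c` in the network `G₂`: `(1,0)` for the first `n` vertices and `(0,1)`
for the last `n` vertices. -/
def g2RetCost (n : ℕ) (i : Fin (2 * n)) : ℝ × ℝ :=
  if i.val < n then (1, 0) else (0, 1)

/-- Each of the two costs is the return cost of exactly `n` of the `2n` vertices. -/
lemma card_filter_g2RetCost_eq (n : ℕ) {c : ℝ × ℝ} (hc : c = (1, 0) ∨ c = (0, 1)) :
    (Finset.univ.filter fun i : Fin (2 * n) => g2RetCost n i = c).card = n := by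
  have h_lt : (Finset.univ.filter fun i : Fin (2 * n) => i.val < n).card = n := by
    rw [Fin.card_filter_val_lt]
    omega
  rcases hc with rfl | rfl
  · simpa [g2RetCost, ite_eq_iff] using h_lt
  · have h_add := Finset.card_filter_add_card_filter_not
      (s := (Finset.univ : Finset (Fin (2 * n)))) (fun i => i.val < n)
    rw [h_lt, Finset.card_univ, Fintype.card_fin] at h_add
    have h_ge : (Finset.univ.filter fun i : Fin (2 * n) => ¬ i.val < n).card = n := by omega
    simpa [g2RetCost, ite_eq_iff] using h_ge

/-- Traversing two edges of the same cost `(1,0)` or `(0,1)` makes some coordinate reach `2`. -/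
lemma two_le_fst_or_two_le_snd_add_self {c : ℝ × ℝ} (hc : c = (1, 0) ∨ c = (0, 1)) :
    2 ≤ (c + c).1 ∨ 2 ≤ (c + c).2 := by
  rcases hc with rfl | rfl <;> norm_num

/-- In `G₂`, for any routing table at `c`, i.e. any choice `f j ∈ {(1,0), (0,1)}` of one of
the two edges from `c` to `v_j` for each destination `v_j`, the routed path from `v_i` to
`v_j` (for `i ≠ j`), namely the edge `v_i → c` followed by the chosen edge `c → v_j`, has
some cost coordinate `≥ 2` for at least `2n(n−1)` ordered pairs `(i, j)` with `i ≠ j`;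
equivalently, the routing finds paths with both cost coordinates `< 2` for at most
`(2n+1)² − 2n(n−1)` of the `(2n+1)²` ordered pairs of vertices of `G₂`. -/
theorem g2_routing_lower_bound (n : ℕ) (hn : 0 < n)
    (f : Fin (2 * n) → ℝ × ℝ) (hf : ∀ j, f j = (1, 0) ∨ f j = (0, 1)) :
    2 * n * (n - 1) ≤
      (Finset.univ.filter (fun ij : Fin (2 * n) × Fin (2 * n) =>
        ij.1 ≠ ij.2 ∧
          (2 ≤ (g2RetCost n ij.1 + f ij.2).1 ∨ 2 ≤ (g2RetCost n ij.1 + f ij.2).2))).card := by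
  rw [Finset.card_filter, Fintype.sum_prod_type_right]
  simp_rw [← Finset.card_filter]
  have h_fiber : ∀ j : Fin (2 * n), n - 1 ≤ (Finset.univ.filter fun i : Fin (2 * n) =>
      i ≠ j ∧ (2 ≤ (g2RetCost n i + f j).1 ∨ 2 ≤ (g2RetCost n i + f j).2)).card := by
    intro j
    calc n - 1 = (Finset.univ.filter fun i => g2RetCost n i = f j).card - 1 := by
          rw [card_filter_g2RetCost_eq n (hf j)]
      _ ≤ ((Finset.univ.filter fun i => g2RetCost n i = f j).erase j).card :=
          Finset.pred_card_le_card_erase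
      _ ≤ _ := by
          refine Finset.card_le_card fun i hi => ?_
          simp only [Finset.mem_erase, Finset.mem_filter, Finset.mem_univ, true_and] at hi ⊢
          rw [hi.2]
          exact ⟨hi.1, two_le_fst_or_two_le_snd_add_self (hf j)⟩
  simpa using Finset.card_nsmul_le_sum Finset.univ _ (n - 1) fun j _ => h_fiber j
end

section
/- Let G be a directed graph with two nonnegative edge weights w1 and w2, let u and v be vertices, and let a ≥ 0. Suppose there exists a directed path P from u to v with Σ_{e∈P} w1(e) ≤ a and Σ_{e∈P} w2(e) ≤ a. If Q is a directed path from u to v that minimizes the composite weight Σ_{e∈Q} (w1(e) + w2(e)) among all directed u–v paths, and Q is infeasible for the strict constraints, i.e., it is not the case that both Σ_{e∈Q} w1(e) < 2a and Σ_{e∈Q} w2(e) < 2a, then (Σ_{e∈Q} w1(e), Σ_{e∈Q} w2(e)) equals either (0, 2a) or (2a, 0). -/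
/-- `IsPath E u v l` : `u :: l` is the list of vertices of a directed path from `u` to `v`
in the directed graph with edge relation `E` (pairwise distinct vertices, consecutive
vertices joined by edges; the empty path is allowed when `u = v`). -/
def IsPath {V : Type*} (E : V → V → Prop) (u v : V) (l : List V) : Prop :=
  List.Chain E u l ∧ (u :: l).getLast (List.cons_ne_nil u l) = v ∧ (u :: l).Nodup

/-- The total weight of the path with vertex list `u :: l`, with respect to the edge
weight function `w`: the sum of `w` over consecutive pairs of vertices. -/
def pathWeight {V : Type*} (w : V → V → ℝ) (u : V) (l : List V) : ℝ :=
  (List.zipWith w (u :: l) l).sum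

theorem pathWeight_nonneg {V : Type*} {E : V → V → Prop} {w : V → V → ℝ}
    (hw : ∀ x y, E x y → 0 ≤ w x y) (u : V) (l : List V) (h : List.IsChain E (u :: l)) :
    0 ≤ pathWeight w u l := by
  induction l generalizing u with
  | nil => simp [pathWeight]
  | cons b l ih =>
    rw [List.isChain_cons_cons] at h
    have := ih b h.2
    simp only [pathWeight, List.zipWith_cons_cons, List.sum_cons] at this ⊢
    exact add_nonneg (hw u b h.1) this

theorem pathWeight_add {V : Type*} (w w' : V → V → ℝ) (u : V) (l : List V) :
    pathWeight (fun x y => w x y + w' x y) u l = pathWeight w u l + pathWeight w' u l := by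
  induction l generalizing u with
  | nil => simp [pathWeight]
  | cons b l ih =>
    have := ih b
    simp only [pathWeight, List.zipWith_cons_cons, List.sum_cons] at this ⊢
    linarith

/-- Suppose there is a directed `u`–`v` path `P` with `w₁`-weight and `w₂`-weight both at
most `a`.  If `Q` is a directed `u`–`v` path minimizing the composite weight `w₁ + w₂`
among all directed `u`–`v` paths, and `Q` fails the strict constraints (it is not the case
that both its `w₁`-weight and its `w₂`-weight are `< 2a`), then its pair of weights equals
`(0, 2a)` or `(2a, 0)`. -/
theorem infeasible_composite_shortest_path_form {V : Type*} (E : V → V → Prop)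
    (w1 w2 : V → V → ℝ)
    (hw1 : ∀ x y, E x y → 0 ≤ w1 x y) (hw2 : ∀ x y, E x y → 0 ≤ w2 x y)
    (u v : V) (a : ℝ) (ha : 0 ≤ a)
    (P : List V) (hP : IsPath E u v P)
    (hP1 : pathWeight w1 u P ≤ a) (hP2 : pathWeight w2 u P ≤ a)
    (Q : List V) (hQ : IsPath E u v Q)
    (hQmin : ∀ R : List V, IsPath E u v R →
      pathWeight (fun x y => w1 x y + w2 x y) u Q ≤
        pathWeight (fun x y => w1 x y + w2 x y) u R)
    (hQinfeas : ¬ (pathWeight w1 u Q < 2 * a ∧ pathWeight w2 u Q < 2 * a)) :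
    (pathWeight w1 u Q, pathWeight w2 u Q) = (0, 2 * a) ∨
    (pathWeight w1 u Q, pathWeight w2 u Q) = (2 * a, 0) := by
  have hQP := hQmin P hP
  rw [pathWeight_add, pathWeight_add] at hQP
  have h1 := pathWeight_nonneg hw1 u Q hQ.1
  have h2 := pathWeight_nonneg hw2 u Q hQ.1
  simp only [Prod.mk.injEq]
  rw [not_and_or, not_lt, not_lt] at hQinfeas
  rcases hQinfeas with h | h
  · exact Or.inr ⟨by linarith, by linarith⟩
  · exact Or.inl ⟨by linarith, by linarith⟩
end

section
/- Let G = (V, E) be a finite directed graph with two nonnegative edge weights w1 and w2. Let 𝒫 be a finite set of ordered pairs (u, v) of distinct vertices, and for each (u, v) ∈ 𝒫 let a_{uv} > 0 be given such that there exists a directed path P from u to v with Σ_{e∈P} w1(e) ≤ a_{uv} and Σ_{e∈P} w2(e) ≤ a_{uv}. Then there exists a next-hop function h : V × V → V, with (x, h(x, v)) an edge of G whenever h is invoked at a vertex x ≠ v en route to destination v, such that for at least half of the pairs (u, v) ∈ 𝒫 the walk u, h(u, v), h(h(u, v), v), … reaches v after finitely many steps and the resulting u–v walk R satisfies Σ_{e∈R}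 w1(e) < 2a_{uv} and Σ_{e∈R} w2(e) < 2a_{uv}. -/
/-- Position after `k` hops of the packet that starts at `u` and is routed toward the
destination `v` by the next-hop function `h` (where `h x v` is the vertex to which a
packet currently at `x` and destined for `v` is forwarded). -/
def hop {V : Type*} (h : V → V → V) (v u : V) (k : ℕ) : V :=
  (fun x => h x v)^[k] u

/-- `WalkTo E w1 w2 v x s t n` : there is a walk of `n` edges from `x` to `v` along `E` whose
total `w1`-weight is `s` and whose total `w2`-weight is `t`. -/
inductive WalkTo {V : Type*} (E : V → V → Prop) (w1 w2 : V → V → ℝ) (v : V) :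
    V → ℝ → ℝ → ℕ → Prop
  | nil : WalkTo E w1 w2 v v 0 0 0
  | cons {x y : V} {s t : ℝ} {n : ℕ} : E x y → WalkTo E w1 w2 v y s t n →
      WalkTo E w1 w2 v x (w1 x y + s) (w2 x y + t) (n + 1)

/-- The edges of `E` followed by the forwarding function `f`. -/
def RouteEdge {V : Type*} (E : V → V → Prop) (f : V → V) (x y : V) : Prop :=
  E x y ∧ y = f x

/-- The combined weight `s + t` is at most that of every walk from `x` to `v`. -/
def IsTight {V : Type*} (E : V → V → Prop) (w1 w2 : V → V → ℝ) (v x : V) (s t : ℝ) : Prop :=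
  ∀ s' t' n', WalkTo E w1 w2 v x s' t' n' → s + t ≤ s' + t'

/-- Some walk from `x` to `v` of minimum combined weight has positive weight in both metrics. -/
def HasMixedTightWalk {V : Type*} (E : V → V → Prop) (w1 w2 : V → V → ℝ) (v x : V) : Prop :=
  ∃ s t n, WalkTo E w1 w2 v x s t n ∧ IsTight E w1 w2 v x s t ∧ 0 < s ∧ 0 < t

section

variable {V : Type*} {E : V → V → Prop} {w1 w2 : V → V → ℝ} {v : V}

theorem WalkTo.swap {x : V} {s t : ℝ} {n : ℕ} (h : WalkTo E w1 w2 v x s t n) :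
    WalkTo E w2 w1 v x t s n := by
  induction h with
  | nil => exact .nil
  | cons he _ ih => exact .cons he ih

theorem WalkTo.of_routeEdge {f : V → V} {x : V} {s t : ℝ} {n : ℕ}
    (h : WalkTo (RouteEdge E f) w1 w2 v x s t n) : WalkTo E w1 w2 v x s t n := by
  induction h with
  | nil => exact .nil
  | cons he _ ih => exact .cons he.1 ih

theorem WalkTo.nonneg (hw1 : ∀ x y, E x y → 0 ≤ w1 x y) (hw2 : ∀ x y, E x y → 0 ≤ w2 x y)
    {x : V} {s t : ℝ} {n : ℕ} (h : WalkTo E w1 w2 v x s t n) : 0 ≤ s ∧ 0 ≤ t := by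
  induction h with
  | nil => simp
  | cons he _ ih => exact ⟨add_nonneg (hw1 _ _ he) ih.1, add_nonneg (hw2 _ _ he) ih.2⟩

theorem IsTight.tail {x y : V} {s t : ℝ} (he : E x y)
    (h : IsTight E w1 w2 v x (w1 x y + s) (w2 x y + t)) : IsTight E w1 w2 v y s t := by
  intro s' t' n' hw
  have := h _ _ _ (.cons he hw)
  linarith

theorem IsTight.cons {x y : V} {s t s' t' : ℝ} {n' : ℕ}
    (h : IsTight E w1 w2 v x (w1 x y + s) (w2 x y + t)) (hw : WalkTo E w1 w2 v y s t n')
    (ht : IsTight E w1 w2 v y s' t') :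
    IsTight E w1 w2 v x (w1 x y + s') (w2 x y + t') := by
  intro a b m hab
  have := h _ _ _ hab
  have := ht _ _ _ hw
  linarith

theorem HasMixedTightWalk.cons (hw1 : ∀ x y, E x y → 0 ≤ w1 x y)
    (hw2 : ∀ x y, E x y → 0 ≤ w2 x y) {x y : V} {s t : ℝ} {n : ℕ} (he : E x y)
    (hw : WalkTo E w1 w2 v y s t n)
    (h : IsTight E w1 w2 v x (w1 x y + s) (w2 x y + t))
    (hy : HasMixedTightWalk E w1 w2 v y) : HasMixedTightWalk E w1 w2 v x := by
  obtain ⟨s', t', n', hw', ht', hs, ht⟩ := hy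
  exact ⟨_, _, _, .cons he hw', h.cons hw ht',
    add_pos_of_nonneg_of_pos (hw1 _ _ he) hs, add_pos_of_nonneg_of_pos (hw2 _ _ he) ht⟩

/-- A single forwarding function realizes, for all vertices, walks to `v` that minimize the
combined weight and, subject to that, the second weight. -/
theorem exists_forwarding_lex_minimal [Finite V]
    (hw1 : ∀ x y, E x y → 0 ≤ w1 x y) (hw2 : ∀ x y, E x y → 0 ≤ w2 x y) :
    ∃ f : V → V, ∀ x, (∃ s t n, WalkTo E w1 w2 v x s t n) →
      ∃ s t n, WalkTo (RouteEdge E f) w1 w2 v x s t n ∧ IsTight E w1 w2 v x s t ∧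
        ∀ s' t' n', WalkTo E w1 w2 v x s' t' n' → s' + t' = s + t → t ≤ t' := by
  classical
  let φ : ℝ → ℝ → ℕ → ℝ ×ₗ ℝ ×ₗ ℕ := fun s t n => toLex (s + t, toLex (t, n))
  have φadd : ∀ a b k s t n, φ (a + s) (b + t) (k + n) = φ a b k + φ s t n := by
    intro a b k s t n
    have : a + s + (b + t) = (a + b) + (s + t) := by ring
    simp only [φ, this]
    rfl
  have φ0 : φ 0 0 0 = 0 := by simp [φ]
  have φpos : ∀ x y, E x y → 0 < φ (w1 x y) (w2 x y) 1 := by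
    intro x y he
    have h1 := hw1 _ _ he
    have h2 := hw2 _ _ he
    rw [← φ0]
    simp only [φ, Prod.Lex.toLex_lt_toLex]
    rcases (add_nonneg h1 h2).lt_or_eq with h | h
    · left; simpa using h
    · rcases h2.lt_or_eq with h' | h'
      · right; exact ⟨by simpa using h, Or.inl h'⟩
      · right; exact ⟨by simpa using h, Or.inr ⟨h', Nat.one_pos⟩⟩
  let C : Set (ℝ ×ₗ ℝ ×ₗ ℕ) :=
    {g | ∃ x y, E x y ∧ g = φ (w1 x y) (w2 x y) 1}
  have hCfin : C.Finite := by
    refine (Set.finite_range (fun p : V × V => φ (w1 p.1 p.2) (w2 p.1 p.2) 1)).subset ?_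
    rintro g ⟨x, y, -, rfl⟩
    exact ⟨(x, y), rfl⟩
  have hwf : (AddSubmonoid.closure C : Set (ℝ ×ₗ ℝ ×ₗ ℕ)).IsWF := by
    refine (Set.IsPWO.addSubmonoid_closure ?_ hCfin.isPWO).isWF
    rintro g ⟨x, y, he, rfl⟩
    exact (φpos x y he).le
  have hmem : ∀ {x s t n}, WalkTo E w1 w2 v x s t n → φ s t n ∈ AddSubmonoid.closure C := by
    intro x s t n h
    induction h with
    | nil => rw [φ0]; exact zero_mem _
    | cons he _ ih =>
      rw [add_comm _ 1, φadd]
      exact add_mem (AddSubmonoid.subset_closure ⟨_, _, he, rfl⟩) ih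
  have hmin : ∀ x, (∃ s t n, WalkTo E w1 w2 v x s t n) → ∃ s t n, WalkTo E w1 w2 v x s t n ∧
      ∀ s' t' n', WalkTo E w1 w2 v x s' t' n' → φ s t n ≤ φ s' t' n' := by
    rintro x ⟨s, t, n, h⟩
    have hsub : {g | ∃ s t n, WalkTo E w1 w2 v x s t n ∧ g = φ s t n} ⊆
        (AddSubmonoid.closure C : Set (ℝ ×ₗ ℝ ×ₗ ℕ)) := by
      rintro g ⟨s, t, n, h, rfl⟩
      exact hmem h
    have hne : {g | ∃ s t n, WalkTo E w1 w2 v x s t n ∧ g = φ s t n}.Nonempty :=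
      ⟨_, s, t, n, h, rfl⟩
    obtain ⟨s0, t0, n0, h0, e0⟩ := (hwf.mono hsub).min_mem hne
    refine ⟨s0, t0, n0, h0, fun s' t' n' h' => ?_⟩
    rw [← e0]
    exact (hwf.mono hsub).min_le hne ⟨s', t', n', h', rfl⟩
  have : Nonempty V := ⟨v⟩
  choose! S T N hW hle using hmin
  have hstep : ∀ x, ∃ y, x ≠ v → (∃ s t n, WalkTo E w1 w2 v x s t n) →
      E x y ∧ ∃ s t n, WalkTo E w1 w2 v y s t n ∧
        φ (S x) (T x) (N x) = φ (w1 x y) (w2 x y) 1 + φ s t n := by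
    intro x
    by_cases hx : ∃ s t n, WalkTo E w1 w2 v x s t n
    · have h := hW x hx
      generalize S x = s at h ⊢
      generalize T x = t at h ⊢
      generalize N x = n at h ⊢
      cases h with
      | nil => exact ⟨v, fun h => absurd rfl h⟩
      | @cons _ y s t n he h =>
        exact ⟨y, fun _ _ => ⟨he, s, t, n, h, by rw [add_comm n 1, φadd]⟩⟩
    · exact ⟨x, fun _ h => absurd h hx⟩
  choose f hf using hstep
  refine ⟨f, ?_⟩
  have key : ∀ g ∈ (AddSubmonoid.closure C : Set (ℝ ×ₗ ℝ ×ₗ ℕ)),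
      ∀ x, (∃ s t n, WalkTo E w1 w2 v x s t n) → φ (S x) (T x) (N x) = g →
      ∃ s t n, WalkTo (RouteEdge E f) w1 w2 v x s t n ∧ φ s t n ≤ g := by
    intro g hg
    refine Set.WellFoundedOn.induction hwf hg (P := fun g => ∀ x,
      (∃ s t n, WalkTo E w1 w2 v x s t n) → φ (S x) (T x) (N x) = g →
      ∃ s t n, WalkTo (RouteEdge E f) w1 w2 v x s t n ∧ φ s t n ≤ g) ?_
    intro g _ ih x hx hxg
    by_cases hxv : x = v
    · subst hxv
      refine ⟨0, 0, 0, .nil, ?_⟩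
      rw [φ0, ← hxg]
      have hpos : ∀ g ∈ AddSubmonoid.closure C, 0 ≤ g := by
        intro g hg
        induction hg using AddSubmonoid.closure_induction with
        | mem g h => obtain ⟨x, y, he, rfl⟩ := h; exact (φpos x y he).le
        | zero => exact le_rfl
        | add a b _ _ ha hb => exact add_nonneg ha hb
      exact hpos _ (hmem (hW x hx))
    · obtain ⟨he, s, t, n, hw, heq⟩ := hf x hxv hx
      have hy : ∃ s t n, WalkTo E w1 w2 v (f x) s t n := ⟨s, t, n, hw⟩
      have h1 : φ (S (f x)) (T (f x)) (N (f x)) ≤ φ s t n := hle _ hy _ _ _ hw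
      have h2 : φ s t n < g := by
        rw [← hxg, heq]
        exact lt_add_of_pos_left _ (φpos _ _ he)
      obtain ⟨s', t', n', hw', hle'⟩ :=
        ih _ (hmem (hW _ hy)) (h1.trans_lt h2) (f x) hy rfl
      refine ⟨_, _, _, .cons ⟨he, rfl⟩ hw', ?_⟩
      rw [add_comm n' 1, φadd, ← hxg, heq]
      exact add_le_add_right (hle'.trans h1) _
  intro x hx
  obtain ⟨s, t, n, hw, hg⟩ := key _ (hmem (hW x hx)) x hx rfl
  have hcmp : ∀ s' t' n', WalkTo E w1 w2 v x s' t' n' →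
      s + t < s' + t' ∨ s + t = s' + t' ∧ t ≤ t' := by
    intro s' t' n' h'
    have := hg.trans (hle x hx _ _ _ h')
    simp only [φ, Prod.Lex.toLex_le_toLex] at this
    rcases this with h | ⟨h, h' | h'⟩
    · exact Or.inl h
    · exact Or.inr ⟨h, h'.le⟩
    · exact Or.inr ⟨h, h'.1.le⟩
  refine ⟨s, t, n, hw, fun s' t' n' h' => ?_, fun s' t' n' h' e => ?_⟩
  · rcases hcmp _ _ _ h' with h | h
    · exact h.le
    · exact h.1.le
  · rcases hcmp _ _ _ h' with h | h
    · exact absurd e h.ne'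
    · exact h.2

/-- Redirecting `f` at vertices with a mixed tight walk does not affect tight walks that start
outside that set. -/
theorem WalkTo.of_eq_off_mixed (hw1 : ∀ x y, E x y → 0 ≤ w1 x y)
    (hw2 : ∀ x y, E x y → 0 ≤ w2 x y) {f g : V → V}
    (hfg : ∀ x, ¬ HasMixedTightWalk E w1 w2 v x → g x = f x)
    {x : V} {s t : ℝ} {n : ℕ} (h : WalkTo (RouteEdge E f) w1 w2 v x s t n)
    (ht : IsTight E w1 w2 v x s t) (hx : ¬ HasMixedTightWalk E w1 w2 v x) :
    WalkTo (RouteEdge E g) w1 w2 v x s t n := by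
  induction h with
  | nil => exact .nil
  | cons he h ih =>
    refine .cons ⟨he.1, ?_⟩ (ih (ht.tail he.1) ?_)
    · rw [hfg _ hx]; exact he.2
    · exact fun hy => hx (hy.cons hw1 hw2 he.1 h.of_routeEdge ht)

/-- Two forwarding functions toward `v`, both tight everywhere, such that every vertex with a
mixed tight walk is routed along a mixed tight walk by one of them. -/
theorem exists_two_tight_forwardings [Finite V]
    (hw1 : ∀ x y, E x y → 0 ≤ w1 x y) (hw2 : ∀ x y, E x y → 0 ≤ w2 x y) :
    ∃ f g : V → V, ∀ x, (∃ s t n, WalkTo E w1 w2 v x s t n) →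
      (∃ s t n, WalkTo (RouteEdge E f) w1 w2 v x s t n ∧ IsTight E w1 w2 v x s t) ∧
      (∃ s t n, WalkTo (RouteEdge E g) w1 w2 v x s t n ∧ IsTight E w1 w2 v x s t) ∧
      (HasMixedTightWalk E w1 w2 v x →
        (∃ s t n, WalkTo (RouteEdge E f) w1 w2 v x s t n ∧ IsTight E w1 w2 v x s t ∧
          0 < s ∧ 0 < t) ∨
        (∃ s t n, WalkTo (RouteEdge E g) w1 w2 v x s t n ∧ IsTight E w1 w2 v x s t ∧
          0 < s ∧ 0 < t)) := by
  classical
  obtain ⟨f, hf⟩ := exists_forwarding_lex_minimal (v := v) hw1 hw2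
  obtain ⟨g, hg'⟩ := exists_forwarding_lex_minimal (v := v) hw2 hw1
  have hg : ∀ x, (∃ s t n, WalkTo E w1 w2 v x s t n) →
      ∃ s t n, WalkTo (RouteEdge E g) w1 w2 v x s t n ∧ IsTight E w1 w2 v x s t ∧
        ∀ s' t' n', WalkTo E w1 w2 v x s' t' n' → s' + t' = s + t → s ≤ s' := by
    rintro x ⟨s, t, n, h⟩
    obtain ⟨t, s, n, h, ht, hmin⟩ := hg' x ⟨t, s, n, h.swap⟩
    refine ⟨s, t, n, h.swap, fun s' t' n' h' => ?_, fun s' t' n' h' e => ?_⟩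
    · linarith [ht _ _ _ h'.swap]
    · exact hmin _ _ _ h'.swap (by linarith)
  have hM : ∀ x, ∃ y s t n, HasMixedTightWalk E w1 w2 v x → E x y ∧ WalkTo E w1 w2 v y s t n ∧
      IsTight E w1 w2 v x (w1 x y + s) (w2 x y + t) ∧ 0 < w1 x y + s ∧ 0 < w2 x y + t ∧
      ∀ s' t' n', WalkTo E w1 w2 v x s' t' n' → IsTight E w1 w2 v x s' t' → 0 < s' → 0 < t' →
        n + 1 ≤ n' := by
    intro x
    by_cases hx : HasMixedTightWalk E w1 w2 v x
    · have hex : ∃ n s t, WalkTo E w1 w2 v x s t n ∧ IsTight E w1 w2 v x s t ∧ 0 < s ∧ 0 < t := by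
        obtain ⟨s, t, n, h⟩ := hx
        exact ⟨n, s, t, h⟩
      obtain ⟨s, t, hw, ht, hs0, ht0⟩ := Nat.find_spec hex
      have hmin : ∀ s' t' n', WalkTo E w1 w2 v x s' t' n' → IsTight E w1 w2 v x s' t' →
          0 < s' → 0 < t' → Nat.find hex ≤ n' :=
        fun s' t' n' a b c d => Nat.find_min' hex ⟨s', t', a, b, c, d⟩
      generalize Nat.find hex = n at hw hmin
      cases hw with
      | nil => exact absurd hs0 (lt_irrefl _)
      | cons he hw => exact ⟨_, _, _, _, fun _ => ⟨he, hw, ht, hs0, ht0, hmin⟩⟩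
    · exact ⟨x, 0, 0, 0, fun h => absurd h hx⟩
  choose Y S T N hY using hM
  let F : V → V := fun x => if HasMixedTightWalk E w1 w2 v x then Y x else f x
  let G : V → V := fun x => if HasMixedTightWalk E w1 w2 v x then Y x else g x
  have hFf : ∀ x, ¬ HasMixedTightWalk E w1 w2 v x → F x = f x := fun x hx => if_neg hx
  have hGg : ∀ x, ¬ HasMixedTightWalk E w1 w2 v x → G x = g x := fun x hx => if_neg hx
  have hFY : ∀ x, HasMixedTightWalk E w1 w2 v x → Y x = F x := fun x hx => (if_pos hx).symm
  have hGY : ∀ x, HasMixedTightWalk E w1 w2 v x → Y x = G x := fun x hx => (if_pos hx).symm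
  let r : V → ℝ ×ₗ ℕ := fun x => toLex (w1 x (Y x) + S x + (w2 x (Y x) + T x), N x + 1)
  have hr : WellFounded (fun x y => r x < r y) :=
    @Finite.wellFounded_of_trans_of_irrefl V _ _ ⟨fun _ _ _ => lt_trans⟩ ⟨fun _ => lt_irrefl _⟩
  refine ⟨F, G, fun x => ?_⟩
  induction x using hr.induction with
  | _ x ih =>
  intro hx
  by_cases hm : HasMixedTightWalk E w1 w2 v x
  swap
  · obtain ⟨s, t, n, h, ht, -⟩ := hf x hx
    obtain ⟨s', t', n', h', ht', -⟩ := hg x hx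
    exact ⟨⟨s, t, n, h.of_eq_off_mixed hw1 hw2 hFf ht hm, ht⟩,
      ⟨s', t', n', h'.of_eq_off_mixed hw1 hw2 hGg ht' hm, ht'⟩, fun h => absurd h hm⟩
  obtain ⟨he, hw, ht, hs0, ht0, hmin⟩ := hY x hm
  have hp := hw1 _ _ he
  have hq := hw2 _ _ he
  have htail := ht.tail he
  have heF : RouteEdge E F x (Y x) := ⟨he, hFY x hm⟩
  have heG : RouteEdge E G x (Y x) := ⟨he, hGY x hm⟩
  by_cases hmy : HasMixedTightWalk E w1 w2 v (Y x)
  · have hlt : r (Y x) < r x := by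
      obtain ⟨he', hw', ht', hs0', ht0', hmin'⟩ := hY (Y x) hmy
      have hle := ht' _ _ _ hw
      simp only [r, Prod.Lex.toLex_lt_toLex]
      by_cases h0 : w1 x (Y x) + w2 x (Y x) = 0
      · have hp0 : w1 x (Y x) = 0 := by linarith
        have hq0 : w2 x (Y x) = 0 := by linarith
        have hn := hmin' _ _ _ hw htail (by linarith) (by linarith)
        have hle' := htail _ _ _ (.cons he' hw')
        right
        exact ⟨by linarith, by omega⟩
      · left
        have : 0 < w1 x (Y x) + w2 x (Y x) := lt_of_le_of_ne (add_nonneg hp hq) (Ne.symm h0)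
        linarith
    obtain ⟨⟨s, t, n, h1, h2⟩, ⟨s', t', n', h1', h2'⟩, h3⟩ := ih _ hlt ⟨_, _, _, hw⟩
    refine ⟨⟨_, _, _, .cons heF h1, ht.cons hw h2⟩, ⟨_, _, _, .cons heG h1', ht.cons hw h2'⟩,
      fun _ => ?_⟩
    rcases h3 hmy with ⟨s, t, n, a, b, c, d⟩ | ⟨s, t, n, a, b, c, d⟩
    · exact Or.inl ⟨_, _, _, .cons heF a, ht.cons hw b, by linarith, by linarith⟩
    · exact Or.inr ⟨_, _, _, .cons heG a, ht.cons hw b, by linarith, by linarith⟩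
  · obtain ⟨s, t, n, h1, h2, h3⟩ := hf _ ⟨_, _, _, hw⟩
    obtain ⟨s', t', n', h1', h2', h3'⟩ := hg _ ⟨_, _, _, hw⟩
    have k := WalkTo.of_eq_off_mixed hw1 hw2 hFf h1 h2 hmy
    have k' := WalkTo.of_eq_off_mixed hw1 hw2 hGg h1' h2' hmy
    obtain ⟨ns, nt⟩ := h1.of_routeEdge.nonneg hw1 hw2
    obtain ⟨ns', nt'⟩ := h1'.of_routeEdge.nonneg hw1 hw2
    obtain ⟨nS, nT⟩ := hw.nonneg hw1 hw2
    have e1 : S x + T x = s + t := le_antisymm (htail _ _ _ h1.of_routeEdge) (h2 _ _ _ hw)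
    have e2 : S x + T x = s' + t' := le_antisymm (htail _ _ _ h1'.of_routeEdge) (h2' _ _ _ hw)
    have hpure : ¬ (0 < S x ∧ 0 < T x) := fun h => hmy ⟨_, _, _, hw, htail, h.1, h.2⟩
    refine ⟨⟨_, _, _, .cons heF k, ht.cons hw h2⟩, ⟨_, _, _, .cons heG k', ht.cons hw h2'⟩,
      fun _ => ?_⟩
    rcases hp.lt_or_eq with hp' | hp'
    · rcases hq.lt_or_eq with hq' | hq'
      · exact Or.inl ⟨_, _, _, .cons heF k, ht.cons hw h2, by linarith, by linarith⟩
      · have hT : 0 < T x := by linarith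
        have hS : S x = 0 := le_antisymm (not_lt.1 fun h => hpure ⟨h, hT⟩) nS
        have := h3' _ _ _ hw e2
        exact Or.inr ⟨_, _, _, .cons heG k', ht.cons hw h2', by linarith, by linarith⟩
    · have hS : 0 < S x := by linarith
      have hT : T x = 0 := le_antisymm (not_lt.1 fun h => hpure ⟨hS, h⟩) nT
      have := h3 _ _ _ hw e1
      exact Or.inl ⟨_, _, _, .cons heF k, ht.cons hw h2, by linarith, by linarith⟩

theorem exists_two_forwardings_lt_two_mul [Finite V]
    (hw1 : ∀ x y, E x y → 0 ≤ w1 x y) (hw2 : ∀ x y, E x y → 0 ≤ w2 x y) :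
    ∃ f g : V → V, ∀ x b, 0 < b → (∃ s t n, WalkTo E w1 w2 v x s t n ∧ s ≤ b ∧ t ≤ b) →
      (∃ s t n, WalkTo (RouteEdge E f) w1 w2 v x s t n ∧ s < 2 * b ∧ t < 2 * b) ∨
      (∃ s t n, WalkTo (RouteEdge E g) w1 w2 v x s t n ∧ s < 2 * b ∧ t < 2 * b) := by
  obtain ⟨f, g, h⟩ := exists_two_tight_forwardings (v := v) hw1 hw2
  refine ⟨f, g, fun x b hb ⟨s, t, n, hw, hs, ht⟩ => ?_⟩
  obtain ⟨⟨s1, t1, n1, h1, h1'⟩, -, hm⟩ := h x ⟨s, t, n, hw⟩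
  by_cases hlt : s1 + t1 < 2 * b
  · have := h1.of_routeEdge.nonneg hw1 hw2
    exact Or.inl ⟨s1, t1, n1, h1, by linarith, by linarith⟩
  · have hle := h1' _ _ _ hw
    have hmix : HasMixedTightWalk E w1 w2 v x := by
      refine ⟨s, t, n, hw, fun s' t' n' h' => ?_, by linarith, by linarith⟩
      linarith [h1' _ _ _ h']
    rcases hm hmix with ⟨s', t', n', hw', ht', c, d⟩ | ⟨s', t', n', hw', ht', c, d⟩
    · have := ht' _ _ _ hw
      exact Or.inl ⟨s', t', n', hw', by linarith, by linarith⟩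
    · have := ht' _ _ _ hw
      exact Or.inr ⟨s', t', n', hw', by linarith, by linarith⟩

theorem IsPath.walkTo {u : V} {l : List V} (h : IsPath E u v l) :
    WalkTo E w1 w2 v u (pathWeight w1 u l) (pathWeight w2 u l) l.length := by
  obtain ⟨hc, hl, -⟩ := h
  induction l generalizing u with
  | nil =>
    simp only [List.getLast_singleton] at hl
    subst hl
    exact .nil
  | cons y l ih =>
    rw [List.getLast_cons (List.cons_ne_nil y l)] at hl
    have hc' := List.isChain_cons_cons.1 hc
    exact .cons hc'.1 (ih hc'.2 hl)

theorem WalkTo.hop {h : V → V → V} {u : V} {s t : ℝ} {n : ℕ}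
    (hw : WalkTo (RouteEdge E fun x => h x v) w1 w2 v u s t n) :
    hop h v u n = v ∧ (∀ k < n, E (hop h v u k) (hop h v u (k + 1))) ∧
      (Finset.range n).sum (fun k => w1 (hop h v u k) (hop h v u (k + 1))) = s ∧
      (Finset.range n).sum (fun k => w2 (hop h v u k) (hop h v u (k + 1))) = t := by
  induction hw with
  | nil => simp [_root_.hop]
  | @cons x y s t n he hw ih =>
    obtain ⟨he, rfl⟩ := he
    obtain ⟨i1, i2, i3, i4⟩ := ih
    have hs : ∀ k, _root_.hop h v x (k + 1) = _root_.hop h v (h x v) k :=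
      fun k => Function.iterate_succ_apply _ _ _
    have h0 : ∀ z, _root_.hop h v z 0 = z := fun z => rfl
    refine ⟨by rw [hs]; exact i1, ?_, ?_, ?_⟩
    · rintro (_ | k) hk
      · simpa only [hs, h0] using he
      · simpa only [hs] using i2 k (by omega)
    · rw [Finset.sum_range_succ', add_comm]
      simp only [hs, h0] at i3 ⊢
      rw [i3]
    · rw [Finset.sum_range_succ', add_comm]
      simp only [hs, h0] at i4 ⊢
      rw [i4]

end

/-- Let `G = (V, E)` be a finite directed graph with two nonnegative edge weights `w₁`,
`w₂`, let `Pairs` be a finite set of ordered pairs of distinct vertices and, for each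
`(u, v) ∈ Pairs`, let `a u v > 0` be such that some directed `u`–`v` path has `w₁`-weight and
`w₂`-weight at most `a u v`.  Then there is a next-hop function `h : V × V → V` such that
for at least half of the pairs `(u, v) ∈ Pairs`, iterating `h` from `u` toward the
destination `v` follows edges of `G` and reaches `v` after finitely many steps, and the
resulting routed `u`–`v` walk has `w₁`-weight and `w₂`-weight strictly less than
`2 · a u v`. -/
theorem distributed_routing_half_feasible {V : Type*} [Fintype V] [DecidableEq V]
    (E : V → V → Prop) (w1 w2 : V → V → ℝ)
    (hw1 : ∀ x y, E x y → 0 ≤ w1 x y) (hw2 : ∀ x y, E x y → 0 ≤ w2 x y)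
    (Pairs : Finset (V × V)) (hne : ∀ p ∈ Pairs, p.1 ≠ p.2)
    (a : V → V → ℝ) (hapos : ∀ p ∈ Pairs, 0 < a p.1 p.2)
    (hfeas : ∀ p ∈ Pairs, ∃ P : List V, IsPath E p.1 p.2 P ∧
      pathWeight w1 p.1 P ≤ a p.1 p.2 ∧ pathWeight w2 p.1 P ≤ a p.1 p.2) :
    ∃ h : V → V → V, ∃ Good : Finset (V × V), Good ⊆ Pairs ∧
      Pairs.card ≤ 2 * Good.card ∧
      ∀ p ∈ Good, ∃ m : ℕ,
        hop h p.2 p.1 m = p.2 ∧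
        (∀ k < m, E (hop h p.2 p.1 k) (hop h p.2 p.1 (k + 1))) ∧
        (Finset.range m).sum (fun k => w1 (hop h p.2 p.1 k) (hop h p.2 p.1 (k + 1)))
          < 2 * a p.1 p.2 ∧
        (Finset.range m).sum (fun k => w2 (hop h p.2 p.1 k) (hop h p.2 p.1 (k + 1)))
          < 2 * a p.1 p.2 := by
  classical
  have hv := fun v => exists_two_forwardings_lt_two_mul (v := v) hw1 hw2
  choose f g hfg using hv
  let good : (V → V → V) → V × V → Prop := fun f p => ∃ s t n,
    WalkTo (RouteEdge E (f p.2)) w1 w2 p.2 p.1 s t n ∧ s < 2 * a p.1 p.2 ∧ t < 2 * a p.1 p.2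
  have hgood : ∀ p ∈ Pairs, good f p ∨ good g p := by
    intro p hp
    obtain ⟨P, hP, h1, h2⟩ := hfeas p hp
    exact hfg p.2 p.1 _ (hapos p hp) ⟨_, _, _, hP.walkTo, h1, h2⟩
  have hcard : Pairs.card ≤ (Pairs.filter (good f)).card + (Pairs.filter (good g)).card := by
    refine le_trans (Finset.card_le_card ?_) (Finset.card_union_le _ _)
    rw [← Finset.filter_or]
    exact fun p hp => Finset.mem_filter.2 ⟨hp, hgood p hp⟩
  suffices ∃ f' : V → V → V, Pairs.card ≤ 2 * (Pairs.filter (good f')).card by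
    obtain ⟨f', hc⟩ := this
    refine ⟨fun x v => f' v x, Pairs.filter (good f'), Finset.filter_subset _ _, hc, ?_⟩
    intro p hp
    obtain ⟨s, t, n, hw, hs, ht⟩ := (Finset.mem_filter.1 hp).2
    obtain ⟨k1, k2, k3, k4⟩ := WalkTo.hop (h := fun x v => f' v x) hw
    exact ⟨n, k1, k2, k3.trans_lt hs, k4.trans_lt ht⟩
  rcases le_total (Pairs.filter (good f)).card (Pairs.filter (good g)).card with h | h
  · exact ⟨g, by omega⟩
  · exact ⟨f, by omega⟩
end

section
/- In the network G_k, for every ordered pair of (not necessarily distinct) vertices (x, y) there exists a directed path from x to y whose total cost is at most (k−1, k−1) in both coordinates; in particular, for every ordered pair there is a path whose total cost is strictly less than k in each coordinate. -/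
/-- A step of a walk: `(target vertex, cost vector of the edge used)`. -/
abbrev Step (V : Type*) := V × (ℝ × ℝ)

/-- `IsCostPath E x y l` : `l` is the list of steps of a directed path from `x` to `y`
in the cost-labeled multigraph with edge predicate `E` (an edge from `a` to `b` with cost
vector `c` exists iff `E a b c`).  The visited vertices are required to be pairwise
distinct (so this is a path, not merely a walk); the empty path is allowed when `x = y`. -/
def IsCostPath {V : Type*} (E : V → V → ℝ × ℝ → Prop) (x y : V) (l : List (Step V)) : Prop :=
  List.Chain (fun a b : Step V => E a.1 b.1 b.2) (x, (0, 0)) l ∧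
  (((x, ((0 : ℝ), (0 : ℝ))) :: l).getLast (by simp)).1 = y ∧
  (x :: l.map Prod.fst).Nodup

/-- Total cost vector of a path given by its list of steps. -/
def pathCost {V : Type*} (l : List (Step V)) : ℝ × ℝ := (l.map Prod.snd).sum

/-- The network `G_k`: vertices are `none` (the centre `c`) and `some i` for
`i : Fin (k*n)` (the vertex `v_{i+1}`).  From `c` to each `v_i` there are `k` edges, of
costs `(j, k−1−j)` for `j = 0, …, k−1`; from `v_i` to `c` there is one edge, of cost
`(ℓ, k−1−ℓ)` where `ℓ = i / n` in the 0-indexed encoding (i.e. `ℓ n < i ≤ (ℓ+1) n` for the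
1-indexed `i`). -/
def GkEdge (k n : ℕ) : Option (Fin (k * n)) → Option (Fin (k * n)) → ℝ × ℝ → Prop :=
  fun x y c =>
    (x = none ∧ (∃ i : Fin (k * n), y = some i) ∧
      ∃ j : ℕ, j < k ∧ c = ((j : ℝ), (k : ℝ) - 1 - (j : ℝ))) ∨
    (y = none ∧ ∃ i : Fin (k * n), x = some i ∧
      c = ((↑(i.val / n) : ℝ), (k : ℝ) - 1 - (↑(i.val / n) : ℝ)))

/-- In `G_k`, every ordered pair of (not necessarily distinct) vertices is joined by a
directed path of total cost at most `(k−1, k−1)`; in particular, by a path whose total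
cost is strictly less than `k` in each coordinate. -/
theorem gk_feasible_paths_exist (k n : ℕ) (hk : 2 ≤ k) (hn : 1 ≤ n)
    (x y : Option (Fin (k * n))) :
    ∃ l : List (Step (Option (Fin (k * n)))),
      IsCostPath (GkEdge k n) x y l ∧
      (pathCost l).1 ≤ (k : ℝ) - 1 ∧ (pathCost l).2 ≤ (k : ℝ) - 1 ∧
      (pathCost l).1 < (k : ℝ) ∧ (pathCost l).2 < (k : ℝ) := by
  have hfib (i : Fin (k * n)) : ((i.val / n : ℕ) : ℝ) ≤ (k : ℝ) - 1 := by
    have h : i.val / n + 1 ≤ k := (Nat.div_lt_iff_lt_mul hn).2 i.isLt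
    have : ((i.val / n : ℕ) : ℝ) + 1 ≤ k := by exact_mod_cast h
    linarith
  have hk' : (2 : ℝ) ≤ k := by exact_mod_cast hk
  suffices h : ∃ l : List (Step (Option (Fin (k * n)))), IsCostPath (GkEdge k n) x y l ∧
      (pathCost l).1 ≤ (k : ℝ) - 1 ∧ (pathCost l).2 ≤ (k : ℝ) - 1 by
    obtain ⟨l, hl, h₁, h₂⟩ := h
    exact ⟨l, hl, h₁, h₂, by linarith, by linarith⟩
  by_cases hxy : x = y
  · subst hxy
    refine ⟨[], ⟨List.isChain_singleton _, by simp, by simp⟩, ?_, ?_⟩ <;> simp [pathCost] <;> linarith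
  rcases x with _ | a <;> rcases y with _ | b
  · exact absurd rfl hxy
  · refine ⟨[(some b, (((0 : ℕ) : ℝ), (k : ℝ) - 1 - ((0 : ℕ) : ℝ)))],
      ⟨?_, by simp, by simp⟩, ?_, ?_⟩
    · exact List.isChain_pair.2 (Or.inl ⟨rfl, ⟨b, rfl⟩, 0, by omega, rfl⟩)
    · simp [pathCost]; linarith
    · simp [pathCost]
  · refine ⟨[(none, (((a.val / n : ℕ) : ℝ), (k : ℝ) - 1 - ((a.val / n : ℕ) : ℝ)))],
      ⟨?_, by simp, by simp⟩, ?_, ?_⟩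
    · exact List.isChain_pair.2 (Or.inr ⟨rfl, a, rfl, rfl⟩)
    · simpa [pathCost] using hfib a
    · simp [pathCost]
  · have hlt : a.val / n < k := (Nat.div_lt_iff_lt_mul hn).2 a.isLt
    have hj : ((k - 1 - a.val / n : ℕ) : ℝ) = (k : ℝ) - 1 - ((a.val / n : ℕ) : ℝ) := by
      rw [Nat.cast_sub (by omega), Nat.cast_sub (by omega), Nat.cast_one]
    refine ⟨[(none, (((a.val / n : ℕ) : ℝ), (k : ℝ) - 1 - ((a.val / n : ℕ) : ℝ))),
      (some b, (((k - 1 - a.val / n : ℕ) : ℝ), (k : ℝ) - 1 - ((k - 1 - a.val / n : ℕ) : ℝ)))],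
      ⟨?_, by simp, by simpa using hxy⟩, ?_, ?_⟩
    · exact List.isChain_cons_cons.2 ⟨Or.inr ⟨rfl, a, rfl, rfl⟩,
        List.isChain_pair.2 (Or.inl ⟨rfl, ⟨b, rfl⟩, _, (Nat.sub_le _ _).trans_lt (by omega), rfl⟩)⟩
    · simp only [pathCost, List.map_cons, List.map_nil, List.sum_cons, List.sum_nil,
        Prod.fst_add, Prod.fst_zero, hj]
      linarith
    · simp only [pathCost, List.map_cons, List.map_nil, List.sum_cons, List.sum_nil,
        Prod.snd_add, Prod.snd_zero, hj]
      linarith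
end

section
/- In the network G_k, consider any routing table at c, i.e., any function f : {1, …, kn} → {0, …, k−1} choosing for each destination v_j the edge from c to v_j with cost vector (f(j), k−1−f(j)), and let the routed path from v_i to v_j (for i ≠ j) be the edge v_i → c followed by the chosen edge c → v_j. Then the number of ordered pairs (i, j) with i ≠ j for which the routed path has some cost coordinate ≥ k is at least kn((k−1)n − 1); equivalently, the routing finds paths with both cost coordinates strictly less than k for at most (kn+1)² − kn((k−1)n − 1) of the (kn+1)² ordered pairs of vertices of G_k. -/
/-- Cost vector of the unique edge from the vertex `v_{i+1}` (0-indexed `i : Fin (k*n)`)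
back to the centre `c` in the network `G_k`: it is `(ℓ, k−1−ℓ)` where `ℓ = i / n` in the
0-indexed encoding (i.e. `ℓ n < i ≤ (ℓ+1) n` for the 1-indexed `i`). -/
def gkRetCost (k n : ℕ) (i : Fin (k * n)) : ℝ × ℝ :=
  ((↑(i.val / n) : ℝ), (k : ℝ) - 1 - (↑(i.val / n) : ℝ))

/-- Cost vector of the edge from the centre `c` to a vertex of `G_k` chosen by the routing
table value `j ∈ {0, …, k−1}`, namely `(j, k−1−j)`. -/
def gkFwdCost (k : ℕ) (j : Fin k) : ℝ × ℝ :=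
  ((j : ℝ), (k : ℝ) - 1 - (j : ℝ))

/-- At most `n` indices share a given quotient by `n`. -/
theorem card_filter_div_eq_le (m n q : ℕ) (hn : 1 ≤ n) :
    (Finset.univ.filter (fun i : Fin m => i.val / n = q)).card ≤ n := by
  have h : (Finset.univ.filter (fun i : Fin m => i.val / n = q)).card ≤
      (Finset.range n).card := by
    refine Finset.card_le_card_of_injOn (fun i => i.val % n) ?_ ?_
    · intro i _
      simpa using Nat.mod_lt _ hn
    · intro a ha b hb hab
      simp only [Finset.coe_filter, Finset.mem_univ, true_and, Set.mem_ofPred_eq] at ha hb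
      apply Fin.ext
      rw [← Nat.div_add_mod a.val n, ← Nat.div_add_mod b.val n, ha, hb]
      exact congrArg _ hab
  simpa using h

/-- A routed path avoids cost `k` in both coordinates only if its first coordinate is `k - 1`. -/
theorem le_cost_or_add_eq (k n : ℕ) (i : Fin (k * n)) (j : Fin k) :
    ((k : ℝ) ≤ (gkRetCost k n i + gkFwdCost k j).1 ∨
      (k : ℝ) ≤ (gkRetCost k n i + gkFwdCost k j).2) ∨ i.val / n = k - 1 - j.val := by
  by_contra! h
  obtain ⟨⟨h₁, h₂⟩, h₃⟩ := h
  simp only [gkRetCost, gkFwdCost, Prod.mk_add_mk] at h₁ h₂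
  have h₄ : i.val / n + j.val < k := by exact_mod_cast h₁
  have h₅ : (k : ℝ) < ((i.val / n + j.val + 2 : ℕ) : ℝ) := by push_cast at h₂ ⊢; linarith
  have h₆ : k < i.val / n + j.val + 2 := by exact_mod_cast h₅
  omega

/-- In `G_k`, for any routing table at `c`, i.e. any choice `f j ∈ {0, …, k−1}` selecting
the edge from `c` to `v_j` with cost vector `(f j, k−1−f j)` for each destination `v_j`,
the routed path from `v_i` to `v_j` (for `i ≠ j`), namely the edge `v_i → c` followed by
the chosen edge `c → v_j`, has some cost coordinate `≥ k` for at least `kn((k−1)n − 1)`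
ordered pairs `(i, j)` with `i ≠ j`; equivalently, the routing finds paths with both cost
coordinates `< k` for at most `(kn+1)² − kn((k−1)n − 1)` of the `(kn+1)²` ordered pairs of
vertices of `G_k`. -/
theorem gk_routing_lower_bound (k n : ℕ) (hk : 2 ≤ k) (hn : 1 ≤ n)
    (f : Fin (k * n) → Fin k) :
    k * n * ((k - 1) * n - 1) ≤
      (Finset.univ.filter (fun ij : Fin (k * n) × Fin (k * n) =>
        ij.1 ≠ ij.2 ∧
          ((k : ℝ) ≤ (gkRetCost k n ij.1 + gkFwdCost k (f ij.2)).1 ∨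
           (k : ℝ) ≤ (gkRetCost k n ij.1 + gkFwdCost k (f ij.2)).2))).card := by
  set S := Finset.univ.filter (fun ij : Fin (k * n) × Fin (k * n) =>
        ij.1 ≠ ij.2 ∧
          ((k : ℝ) ≤ (gkRetCost k n ij.1 + gkFwdCost k (f ij.2)).1 ∨
           (k : ℝ) ≤ (gkRetCost k n ij.1 + gkFwdCost k (f ij.2)).2)) with hS
  have hfib : ∀ j : Fin (k * n), (k - 1) * n - 1 ≤ (S.filter (fun ij => ij.2 = j)).card := by
    intro j
    set G := Finset.univ.filter (fun i : Fin (k * n) => i.val / n = k - 1 - (f j).val) with hG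
    have hcover : (Finset.univ : Finset (Fin (k * n))) ⊆
        ((S.filter (fun ij => ij.2 = j)).image Prod.fst ∪ G) ∪ {j} := by
      intro i _
      by_cases hij : i = j
      · simp [hij]
      · rcases le_cost_or_add_eq k n i (f j) with h | h
        · refine Finset.mem_union_left _ (Finset.mem_union_left _ ?_)
          exact Finset.mem_image.2 ⟨(i, j), by simpa [hS] using ⟨hij, h⟩, rfl⟩
        · exact Finset.mem_union_left _ (Finset.mem_union_right _ (by simp [hG, h]))
    have h₁ := (Finset.card_le_card hcover).trans (Finset.card_union_le _ _)
    have h₂ := Finset.card_union_le ((S.filter (fun ij => ij.2 = j)).image Prod.fst) G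
    have h₃ : ((S.filter (fun ij => ij.2 = j)).image Prod.fst).card ≤ _ := Finset.card_image_le
    have h₄ : G.card ≤ n := card_filter_div_eq_le _ _ _ hn
    rw [Finset.card_univ, Fintype.card_fin, Finset.card_singleton] at h₁
    rw [Nat.sub_mul, one_mul]
    omega
  rw [Finset.card_eq_sum_card_fiberwise (f := Prod.snd) (t := Finset.univ) (by simp)]
  simpa using Finset.card_nsmul_le_sum Finset.univ _ _ (fun j _ => hfib j)
end
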